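/- arXiv:0706.3483 — 5 statements merged into one kernel-verified Lean document; each statement's English description precedes it below -/
import Mathlib

section
/- Let a < b be real numbers and let I : ℝ → ℝ be positive and twice differentiable on (a, b), with I'(V) ≥ 0 for all V ∈ (a, b). Suppose that the differential inequality I''(V)·I(V)² + (3/4)·I'(V)²·I(V) + 3·I(V) ≤ 4π holds for all V ∈ (a, b). Then the function m_H(V) = √(I(V))·(16π − 4·I(V) − I(V)·I'(V)²) is monotone nondecreasing on (a, b). -/
open Real

/-- The adapted Hawking mass has derivative
`(2 I' / √I) (4π − 3I − (3/4) I'² I − I'' I²)` wherever `I` is positive and twice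
differentiable. -/
theorem hasDerivAt_adapted_hawking_mass {I : ℝ → ℝ} {V : ℝ} (hpos : 0 < I V)
    (hdiff : DifferentiableAt ℝ I V) (hdiff' : DifferentiableAt ℝ (deriv I) V) :
    HasDerivAt (fun V => √(I V) * (16 * π - 4 * I V - I V * (deriv I V) ^ 2))
      (2 * deriv I V / √(I V) *
        (4 * π - (deriv (deriv I) V * (I V) ^ 2 + (3 / 4) * (deriv I V) ^ 2 * I V + 3 * I V)))
      V := by
  have h := hdiff.hasDerivAt
  have hs : √(I V) ≠ 0 := (Real.sqrt_pos.2 hpos).ne'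
  have hsq : √(I V) ^ 2 = I V := Real.sq_sqrt hpos.le
  refine ((h.sqrt hpos.ne').mul
    (((h.const_mul 4).const_sub (16 * π)).sub (h.mul (hdiff'.hasDerivAt.pow 2)))).congr_deriv ?_
  simp only [Pi.sub_apply, Pi.mul_apply, Pi.pow_apply]
  field_simp
  rw [hsq]
  push_cast
  ring

/-- Smooth analytic core of Bray's monotonicity theorem: if `I > 0` is twice
differentiable on `(a, b)` with `I' ≥ 0` and satisfies the differential inequality
`I''·I² + (3/4)·I'²·I + 3·I ≤ 4π`, then the adapted Hawking mass
`m_H = √I·(16π − 4I − I·I'²)` is nondecreasing on `(a, b)`. -/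
theorem adapted_hawking_mass_monotone
    (a b : ℝ) (hab : a < b) (I : ℝ → ℝ)
    (hpos : ∀ V ∈ Set.Ioo a b, 0 < I V)
    (hdiff : ∀ V ∈ Set.Ioo a b, DifferentiableAt ℝ I V)
    (hdiff' : ∀ V ∈ Set.Ioo a b, DifferentiableAt ℝ (deriv I) V)
    (hI' : ∀ V ∈ Set.Ioo a b, 0 ≤ deriv I V)
    (hineq : ∀ V ∈ Set.Ioo a b,
      deriv (deriv I) V * (I V) ^ 2 + (3 / 4) * (deriv I V) ^ 2 * I V + 3 * I V
        ≤ 4 * π) :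
    MonotoneOn
      (fun V => Real.sqrt (I V) * (16 * π - 4 * I V - I V * (deriv I V) ^ 2))
      (Set.Ioo a b) := by
  have hd := fun V hV =>
    hasDerivAt_adapted_hawking_mass (hpos V hV) (hdiff V hV) (hdiff' V hV)
  refine monotoneOn_of_hasDerivWithinAt_nonneg (convex_Ioo a b)
    (fun V hV => (hd V hV).continuousAt.continuousWithinAt)
    (fun V hV => (hd V (interior_subset hV)).hasDerivWithinAt) fun V hV => ?_
  replace hV := interior_subset hV
  exact mul_nonneg
    (div_nonneg (mul_nonneg zero_le_two (hI' V hV)) (Real.sqrt_nonneg _))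
    (sub_nonneg.2 (hineq V hV))
end

section
/- Let a < b be real numbers and let I : ℝ → ℝ be positive and twice differentiable on (a, b) with I'(V) ≥ 0 and I''(V)·I(V)² + (3/4)·I'(V)²·I(V) + 3·I(V) ≤ 4π for all V ∈ (a, b). Define m_H(V) = √(I(V))·(16π − 4·I(V) − I(V)·I'(V)²). Suppose m_H(V) → 0 as V → a from the right, and m_H(V₀) ≤ 0 for some V₀ ∈ (a, b). Then m_H vanishes identically on (a, V₀]; in particular I(V)·I'(V)² = 16π − 4·I(V), i.e. I'(V) = √((16π − 4·I(V))/I(V)), for all V ∈ (a, V₀]. -/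
open Real Filter

/-- The derivative of `√I·(16π − 4I − I·I'²)`. -/
theorem hasDerivAt_adaptedHawkingMass {I : ℝ → ℝ} {V : ℝ} (hpos : 0 < I V)
    (hI : DifferentiableAt ℝ I V) (hI' : DifferentiableAt ℝ (deriv I) V) :
    HasDerivAt (fun W => √(I W) * (16 * π - 4 * I W - I W * (deriv I W) ^ 2))
      (2 * deriv I V / √(I V) *
        (4 * π - (deriv (deriv I) V * (I V) ^ 2 + (3 / 4) * (deriv I V) ^ 2 * I V + 3 * I V)))
      V := by
  have h₁ := hI.hasDerivAt
  have h₂ := hI'.hasDerivAt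
  refine ((h₁.sqrt hpos.ne').mul
    (((h₁.const_mul 4).const_sub (16 * π)).sub (h₁.mul (h₂.pow 2)))).congr_deriv ?_
  have hs : √(I V) ≠ 0 := (Real.sqrt_pos.2 hpos).ne'
  have hsq : √(I V) ^ 2 = I V := Real.sq_sqrt hpos.le
  simp only [Pi.sub_apply, Pi.mul_apply, Pi.pow_apply]
  field_simp
  rw [hsq]
  push_cast
  ring

/-- A monotone function on `(a, b)` with right limit `l` at `a` is bounded below by `l`. -/
theorem MonotoneOn.le_of_tendsto_nhdsGT {f : ℝ → ℝ} {a b l x : ℝ}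
    (hf : MonotoneOn f (Set.Ioo a b)) (hl : Tendsto f (nhdsWithin a (Set.Ioi a)) (nhds l))
    (hx : x ∈ Set.Ioo a b) : l ≤ f x := by
  refine le_of_tendsto hl ?_
  filter_upwards [Ioo_mem_nhdsGT hx.1] with y hy
  exact hf ⟨hy.1, hy.2.trans hx.2⟩ hx hy.2.le

/-- If `I > 0` is twice differentiable on `(a, b)` with `I' ≥ 0` and satisfies
`I''·I² + (3/4)·I'²·I + 3·I ≤ 4π`, and the adapted Hawking mass
`m_H = √I·(16π − 4I − I·I'²)` tends to `0` as `V → a⁺` and is nonpositive at some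
`V₀ ∈ (a, b)`, then `m_H` vanishes identically on `(a, V₀]`; in particular
`I' = √((16π − 4I)/I)` on `(a, V₀]`. -/
theorem adapted_hawking_mass_rigidity
    (a b : ℝ) (hab : a < b) (I : ℝ → ℝ)
    (hpos : ∀ V ∈ Set.Ioo a b, 0 < I V)
    (hdiff : ∀ V ∈ Set.Ioo a b, DifferentiableAt ℝ I V)
    (hdiff' : ∀ V ∈ Set.Ioo a b, DifferentiableAt ℝ (deriv I) V)
    (hI' : ∀ V ∈ Set.Ioo a b, 0 ≤ deriv I V)
    (hineq : ∀ V ∈ Set.Ioo a b,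
      deriv (deriv I) V * (I V) ^ 2 + (3 / 4) * (deriv I V) ^ 2 * I V + 3 * I V
        ≤ 4 * π)
    (mH : ℝ → ℝ)
    (hmH : ∀ V, mH V = Real.sqrt (I V) * (16 * π - 4 * I V - I V * (deriv I V) ^ 2))
    (hlim : Tendsto mH (nhdsWithin a (Set.Ioi a)) (nhds 0))
    (V₀ : ℝ) (hV₀ : V₀ ∈ Set.Ioo a b) (hmH₀ : mH V₀ ≤ 0) :
    ∀ V ∈ Set.Ioc a V₀,
      mH V = 0 ∧
      I V * (deriv I V) ^ 2 = 16 * π - 4 * I V ∧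
      deriv I V = Real.sqrt ((16 * π - 4 * I V) / I V) := by
  have hderiv : ∀ V ∈ Set.Ioo a b, HasDerivAt mH _ V := fun V hV => by
    rw [funext hmH]
    exact hasDerivAt_adaptedHawkingMass (hpos V hV) (hdiff V hV) (hdiff' V hV)
  have hmono : MonotoneOn mH (Set.Ioo a b) := by
    refine monotoneOn_of_deriv_nonneg (convex_Ioo a b)
      (fun V hV => (hderiv V hV).continuousAt.continuousWithinAt) ?_ ?_ <;>
      rw [interior_Ioo]
    · exact fun V hV => (hderiv V hV).differentiableAt.differentiableWithinAt
    · intro V hV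
      rw [(hderiv V hV).deriv]
      exact mul_nonneg (div_nonneg (mul_nonneg zero_le_two (hI' V hV)) (Real.sqrt_nonneg _))
        (sub_nonneg.2 (hineq V hV))
  intro V hV
  have hVab : V ∈ Set.Ioo a b := ⟨hV.1, hV.2.trans_lt hV₀.2⟩
  have hIV := hpos V hVab
  have hzero : mH V = 0 :=
    le_antisymm ((hmono hVab hV₀ hV.2).trans hmH₀) (hmono.le_of_tendsto_nhdsGT hlim hVab)
  have hode : I V * (deriv I V) ^ 2 = 16 * π - 4 * I V := by
    have h := (mul_eq_zero.1 ((hmH V).symm.trans hzero)).resolve_left (Real.sqrt_pos.2 hIV).ne'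
    linarith
  refine ⟨hzero, hode, ?_⟩
  rw [← hode, mul_div_cancel_left₀ _ hIV.ne', Real.sqrt_sq (hI' V hVab)]
end

section
/- Let A ∈ (0, ∞], let F : ℝ → ℝ be continuous and strictly positive on (0, A), and let T > 0. Suppose f, g : ℝ → ℝ are continuous on [0, T], take values in [0, A) on [0, T], satisfy f(0) = g(0) = 0, are strictly positive on (0, T], and are differentiable on (0, T) with f'(t) = F(f(t)) and g'(t) = F(g(t)) for all t ∈ (0, T). Then f(t) = g(t) for all t ∈ [0, T]. -/
open Real

/-- A continuous function on an open order-connected set of reals has an antiderivative there. -/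
lemma exists_antiderivative_of_continuousOn {u : ℝ → ℝ} {U : Set ℝ} (hU : IsOpen U)
    (hUc : U.OrdConnected) (hu : ContinuousOn u U) :
    ∃ H : ℝ → ℝ, ∀ x ∈ U, HasDerivAt H (u x) x := by
  rcases U.eq_empty_or_nonempty with rfl | ⟨c, hc⟩
  · exact ⟨0, fun x hx => hx.elim⟩
  · refine ⟨fun x => ∫ y in c..x, u y, fun x hx => ?_⟩
    refine intervalIntegral.integral_hasDerivAt_right ?_ ?_ (hu.continuousAt (hU.mem_nhds hx))
    · exact (hu.mono (hUc.uIcc_subset hc hx)).intervalIntegrable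
    · exact hu.stronglyMeasurableAtFilter hU x hx

/-- Along a solution of `f' = F ∘ f`, an antiderivative of `1 / F` equals time up to a constant. -/
lemma exists_antiderivative_comp_eq_add {F H f : ℝ → ℝ} {U : Set ℝ} {T : ℝ}
    (hF : ∀ x ∈ U, F x ≠ 0) (hH : ∀ x ∈ U, HasDerivAt H (F x)⁻¹ x)
    (hfU : ∀ t ∈ Set.Ioo 0 T, f t ∈ U) (hf : ∀ t ∈ Set.Ioo 0 T, HasDerivAt f (F (f t)) t) :
    ∃ a, ∀ t ∈ Set.Ioo 0 T, H (f t) = t + a := by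
  have hd : ∀ t ∈ Set.Ioo 0 T, HasDerivAt (fun s => H (f s) - s) 0 t := fun t ht => by
    have h := ((hH _ (hfU t ht)).comp t (hf t ht)).sub (hasDerivAt_id t)
    rwa [inv_mul_cancel₀ (hF _ (hfU t ht)), sub_self] at h
  obtain ⟨a, ha⟩ := isOpen_Ioo.exists_is_const_of_deriv_eq_zero isPreconnected_Ioo
    (fun t ht => (hd t ht).differentiableAt.differentiableWithinAt) (fun t ht => (hd t ht).deriv)
  exact ⟨a, fun t ht => by linarith [ha t ht]⟩

/-- Two continuous functions vanishing at `0` and positive afterwards take a common value at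
arbitrarily small positive times. -/
lemma exists_common_value {f g : ℝ → ℝ} {ε : ℝ} (hε : 0 < ε)
    (hfc : ContinuousOn f (Set.Icc 0 ε)) (hgc : ContinuousOn g (Set.Icc 0 ε))
    (hf0 : f 0 = 0) (hg0 : g 0 = 0) (hf : 0 < f ε) (hg : 0 < g ε) :
    ∃ s ∈ Set.Ioo 0 ε, ∃ t ∈ Set.Ioo 0 ε, f s = g t := by
  obtain ⟨y, hy0, hy⟩ := exists_between (lt_min hf hg)
  obtain ⟨s, hs, hfs⟩ := intermediate_value_Ioo hε.le hfc
    ⟨hf0.symm ▸ hy0, hy.trans_le (min_le_left _ _)⟩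
  obtain ⟨t, ht, hgt⟩ := intermediate_value_Ioo hε.le hgc
    ⟨hg0.symm ▸ hy0, hy.trans_le (min_le_right _ _)⟩
  exact ⟨s, hs, t, ht, hfs.trans hgt.symm⟩

/-- Uniqueness for the singular autonomous initial value problem `I' = F(I)`, `I(0) = 0`:
if `F` is continuous and strictly positive on `(0, A)` (with `A ∈ (0, ∞]`), and `f, g` are
continuous on `[0, T]`, take values in `[0, A)`, vanish at `0`, are strictly positive on
`(0, T]`, and solve `f' = F ∘ f`, `g' = F ∘ g` on `(0, T)`, then `f = g` on `[0, T]`. -/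
theorem singular_ode_uniqueness
    (A : EReal) (hA : 0 < A)
    (F : ℝ → ℝ)
    (hFc : ContinuousOn F {x : ℝ | 0 < x ∧ (x : EReal) < A})
    (hFpos : ∀ x : ℝ, 0 < x → (x : EReal) < A → 0 < F x)
    (T : ℝ) (hT : 0 < T)
    (f g : ℝ → ℝ)
    (hfc : ContinuousOn f (Set.Icc 0 T)) (hgc : ContinuousOn g (Set.Icc 0 T))
    (hfrange : ∀ t ∈ Set.Icc 0 T, 0 ≤ f t ∧ (f t : EReal) < A)
    (hgrange : ∀ t ∈ Set.Icc 0 T, 0 ≤ g t ∧ (g t : EReal) < A)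
    (hf0 : f 0 = 0) (hg0 : g 0 = 0)
    (hfpos : ∀ t ∈ Set.Ioc 0 T, 0 < f t)
    (hgpos : ∀ t ∈ Set.Ioc 0 T, 0 < g t)
    (hf' : ∀ t ∈ Set.Ioo 0 T, HasDerivAt f (F (f t)) t)
    (hg' : ∀ t ∈ Set.Ioo 0 T, HasDerivAt g (F (g t)) t) :
    ∀ t ∈ Set.Icc 0 T, f t = g t := by
  set U : Set ℝ := {x : ℝ | 0 < x ∧ (x : EReal) < A}
  have hU : IsOpen U :=
    isOpen_Ioi.inter (isOpen_Iio.preimage continuous_coe_real_ereal)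
  have hUc : U.OrdConnected := ⟨fun x hx y hy z hz =>
    ⟨hx.1.trans_le hz.1, (EReal.coe_le_coe_iff.2 hz.2).trans_lt hy.2⟩⟩
  have hFU : ∀ x ∈ U, 0 < F x := fun x hx => hFpos x hx.1 hx.2
  have hF0 : ∀ x ∈ U, F x ≠ 0 := fun x hx => (hFU x hx).ne'
  obtain ⟨H, hH⟩ := exists_antiderivative_of_continuousOn hU hUc (hFc.inv₀ hF0)
  have hmono : StrictMonoOn H U := by
    refine strictMonoOn_of_deriv_pos hUc.convex
      (fun x hx => (hH x hx).continuousAt.continuousWithinAt) fun x hx => ?_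
    rw [(hH x (interior_subset hx)).deriv]
    exact inv_pos.2 (hFU x (interior_subset hx))
  have hfU : ∀ t ∈ Set.Ioo 0 T, f t ∈ U := fun t ht =>
    ⟨hfpos t (Set.Ioo_subset_Ioc_self ht), (hfrange t (Set.Ioo_subset_Icc_self ht)).2⟩
  have hgU : ∀ t ∈ Set.Ioo 0 T, g t ∈ U := fun t ht =>
    ⟨hgpos t (Set.Ioo_subset_Ioc_self ht), (hgrange t (Set.Ioo_subset_Icc_self ht)).2⟩
  obtain ⟨a, ha⟩ := exists_antiderivative_comp_eq_add hF0 hH hfU hf'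
  obtain ⟨b, hb⟩ := exists_antiderivative_comp_eq_add hF0 hH hgU hg'
  have hab : a = b := by
    by_contra hne
    have hε : 0 < min T |a - b| := lt_min hT (abs_pos.2 (sub_ne_zero.2 hne))
    have hεT : min T |a - b| ≤ T := min_le_left _ _
    obtain ⟨s, hs, t, ht, hst⟩ := exists_common_value hε
      (hfc.mono (Set.Icc_subset_Icc_right hεT)) (hgc.mono (Set.Icc_subset_Icc_right hεT))
      hf0 hg0 (hfpos _ ⟨hε, hεT⟩) (hgpos _ ⟨hε, hεT⟩)
    have h : s + a = t + b := by
      rw [← ha s ⟨hs.1, hs.2.trans_le hεT⟩, ← hb t ⟨ht.1, ht.2.trans_le hεT⟩, hst]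
    have hlt : |a - b| < min T |a - b| :=
      abs_lt.2 ⟨by linarith [hs.2, ht.1], by linarith [hs.1, ht.2]⟩
    exact (hlt.trans_le (min_le_right _ _)).false
  have heq : Set.EqOn f g (Set.Ioo 0 T) := fun t ht =>
    hmono.injOn (hfU t ht) (hgU t ht) (by rw [ha t ht, hb t ht, hab])
  exact heq.of_subset_closure hfc hgc Set.Ioo_subset_Icc_self (closure_Ioo hT.ne).ge
end

section
/- Let v(r) = 2πr − π·sin(2r) and let V₀ ∈ (0, π²]. Suppose I : ℝ → ℝ is continuous on [0, V₀] with I(0) = 0, 0 < I(V) < 4π for all V ∈ (0, V₀), and I is differentiable on (0, V₀) with I'(V) = √((16π − 4·I(V))/I(V)) for all V ∈ (0, V₀). Then for every r ∈ [0, π/2] with v(r) ≤ V₀ one has I(v(r)) = 4π·sin²(r). -/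
open Real

lemma hasDerivAt_ballVolume (r : ℝ) :
    HasDerivAt (fun r : ℝ => 2 * π * r - π * Real.sin (2 * r)) (4 * π * Real.sin r ^ 2) r := by
  have h2 : HasDerivAt (fun r : ℝ => 2 * r) 2 r := by
    simpa using (hasDerivAt_id r).const_mul 2
  have h := ((hasDerivAt_id r).const_mul (2 * π)).sub (h2.sin.const_mul π)
  refine h.congr_deriv ?_
  rw [Real.cos_two_mul, Real.cos_sq']
  ring

lemma strictMonoOn_ballVolume :
    StrictMonoOn (fun r : ℝ => 2 * π * r - π * Real.sin (2 * r)) (Set.Icc 0 (π / 2)) := by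
  refine strictMonoOn_of_deriv_pos (convex_Icc _ _) (by fun_prop) fun x hx => ?_
  rw [interior_Icc] at hx
  rw [(hasDerivAt_ballVolume x).deriv]
  have := Real.sin_pos_of_pos_of_lt_pi hx.1 (by linarith [hx.2, Real.pi_pos])
  positivity

/-- Along a solution of the ODE, the volume of the ball whose boundary area is `I V` has
derivative one. -/
lemma hasDerivAt_ballVolume_arcsin_sqrt {I : ℝ → ℝ} {V : ℝ} (hpos : 0 < I V)
    (hlt : I V < 4 * π)
    (hI : HasDerivAt I (Real.sqrt ((16 * π - 4 * I V) / I V)) V) :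
    HasDerivAt (fun V => 2 * π * Real.arcsin (Real.sqrt (I V / (4 * π)))
      - π * Real.sin (2 * Real.arcsin (Real.sqrt (I V / (4 * π))))) 1 V := by
  have hπ := Real.pi_pos
  have hx : 0 < I V / (4 * π) := by positivity
  have hx1 : I V / (4 * π) < 1 := by rwa [div_lt_one (by positivity)]
  set s := Real.sqrt (I V / (4 * π)) with hs
  have hs0 : 0 < s := Real.sqrt_pos.2 hx
  have hss : s ^ 2 = I V / (4 * π) := Real.sq_sqrt hx.le
  have hs1 : s < 1 := by nlinarith
  have hIs : I V = 4 * π * s ^ 2 := by rw [hss]; field_simp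
  have hc0 : 0 < Real.sqrt (1 - s ^ 2) := Real.sqrt_pos.2 (by nlinarith)
  have hslope : Real.sqrt ((16 * π - 4 * I V) / I V) = 2 * Real.sqrt (1 - s ^ 2) / s := by
    rw [← Real.sqrt_sq (by positivity : 0 ≤ 2 * Real.sqrt (1 - s ^ 2) / s), div_pow, mul_pow,
      Real.sq_sqrt (by nlinarith), hIs]
    congr 1
    field_simp
    ring
  rw [hslope] at hI
  have hR := (Real.hasDerivAt_arcsin (by linarith : s ≠ -1) hs1.ne).comp V
    ((hI.div_const (4 * π)).sqrt hx.ne')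
  refine ((hasDerivAt_ballVolume (Real.arcsin s)).comp V hR).congr_deriv ?_
  rw [Real.sin_arcsin (by linarith) hs1.le, ← hs]
  field_simp

/-- The unique solution of the ODE `I' = √((16π − 4I)/I)` with `I(0) = 0` is the
isoperimetric profile of the round unit 3-sphere: `I (2πr − π sin 2r) = 4π sin² r`. -/
theorem ode_solution_is_sphere_profile
    (v : ℝ → ℝ) (hv : ∀ r : ℝ, v r = 2 * π * r - π * Real.sin (2 * r))
    (V₀ : ℝ) (hV₀ : V₀ ∈ Set.Ioc 0 (π ^ 2))
    (I : ℝ → ℝ)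
    (hIc : ContinuousOn I (Set.Icc 0 V₀))
    (hI0 : I 0 = 0)
    (hIrange : ∀ V ∈ Set.Ioo 0 V₀, 0 < I V ∧ I V < 4 * π)
    (hI' : ∀ V ∈ Set.Ioo 0 V₀,
      HasDerivAt I (Real.sqrt ((16 * π - 4 * I V) / I V)) V) :
    ∀ r ∈ Set.Icc 0 (π / 2), v r ≤ V₀ → I (v r) = 4 * π * Real.sin r ^ 2 := by
  obtain rfl : v = fun r => 2 * π * r - π * Real.sin (2 * r) := funext hv
  intro r hr hrV
  have hπ := Real.pi_pos
  rcases hr.1.eq_or_lt with rfl | hr0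
  · simp [hI0]
  set W := 2 * π * r - π * Real.sin (2 * r) with hW
  have hWpos : 0 < W := by
    simpa [hW] using strictMonoOn_ballVolume ⟨le_rfl, by positivity⟩ hr hr0
  have hmaps : Set.MapsTo I (Set.Icc 0 V₀) (Set.Icc 0 (4 * π)) := by
    have h : Set.MapsTo I (Set.Ioo 0 V₀) (Set.Ioo 0 (4 * π)) := hIrange
    have h' := h.closure_of_continuousOn (by rwa [closure_Ioo hV₀.1.ne])
    rwa [closure_Ioo hV₀.1.ne, closure_Ioo (by positivity)] at h'
  have hIW : I W ∈ Set.Icc 0 (4 * π) := hmaps ⟨hWpos.le, hrV⟩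
  have hIcW : ContinuousOn I (Set.Icc 0 W) := hIc.mono (Set.Icc_subset_Icc_right hrV)
  have hcont : ContinuousOn (fun V => 2 * π * Real.arcsin (Real.sqrt (I V / (4 * π)))
      - π * Real.sin (2 * Real.arcsin (Real.sqrt (I V / (4 * π))))) (Set.Icc 0 W) := by
    have hR : ContinuousOn (fun V => Real.arcsin (Real.sqrt (I V / (4 * π)))) (Set.Icc 0 W) :=
      Real.continuous_arcsin.comp_continuousOn (hIcW.div_const _).sqrt
    fun_prop
  obtain ⟨c, -, hc⟩ := exists_hasDerivAt_eq_slope _ (fun _ => 1) hWpos hcont fun V hV =>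
    have hV' : V ∈ Set.Ioo 0 V₀ := ⟨hV.1, hV.2.trans_le hrV⟩
    hasDerivAt_ballVolume_arcsin_sqrt (hIrange V hV').1 (hIrange V hV').2 (hI' V hV')
  have hvol : 2 * π * Real.arcsin (Real.sqrt (I W / (4 * π)))
      - π * Real.sin (2 * Real.arcsin (Real.sqrt (I W / (4 * π)))) = W := by
    rw [eq_div_iff (by linarith)] at hc
    simp only [hI0, zero_div, Real.sqrt_zero, Real.arcsin_zero, mul_zero, Real.sin_zero] at hc
    linarith
  have hrad : Real.arcsin (Real.sqrt (I W / (4 * π))) = r :=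
    strictMonoOn_ballVolume.injOn
      ⟨Real.arcsin_nonneg.2 (Real.sqrt_nonneg _), Real.arcsin_le_pi_div_two _⟩ hr hvol
  have hle : Real.sqrt (I W / (4 * π)) ≤ 1 :=
    Real.sqrt_le_one.2 ((div_le_one (by positivity)).2 hIW.2)
  change I W = _
  rw [← hrad, Real.sin_arcsin (by linarith [Real.sqrt_nonneg (I W / (4 * π))]) hle,
    Real.sq_sqrt (div_nonneg hIW.1 (by positivity))]
  field_simp
end

section
/- Let c₁, c₂ ∈ ℝ and let V, A : ℝ → ℝ be functions such that, as r → 0⁺, V(r) = (4π/3)·r³·(1 + c₁·r² + c₂·r⁴) + O(r⁹) and A(r) = 4π·r²·(1 + (5/3)·c₁·r² + (7/3)·c₂·r⁴) + O(r⁸). Define W(r) = (3·V(r)/(4π))^{1/3}. Then, as r → 0⁺, A(r) = 4π·W(r)²·(1 + c₁·W(r)² + (−(11/9)·c₁² + (5/3)·c₂)·W(r)⁴) + O(r⁸). -/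
open Real Filter Asymptotics

/-- If `W ≥ 0` and `P ≥ r / 2`, closeness of the cubes to order `n + 2` as `r → 0⁺` gives
closeness of `W` and `P` to order `n`. -/
theorem isBigO_sub_of_isBigO_cube_sub {W P : ℝ → ℝ} {n : ℕ}
    (hW : ∀ᶠ r in nhdsWithin 0 (Set.Ioi 0), 0 ≤ W r)
    (hP : ∀ᶠ r in nhdsWithin 0 (Set.Ioi 0), r / 2 ≤ P r)
    (h : (fun r => W r ^ 3 - P r ^ 3) =O[nhdsWithin 0 (Set.Ioi 0)] fun r => r ^ (n + 2)) :
    (fun r => W r - P r) =O[nhdsWithin 0 (Set.Ioi 0)] fun r => r ^ n := by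
  obtain ⟨C, hC⟩ := h.bound
  refine IsBigO.of_bound (4 * C) ?_
  filter_upwards [hW, hP, hC, self_mem_nhdsWithin] with r hw hp hc hr
  have hr : 0 < r := hr
  have hfac : W r ^ 3 - P r ^ 3 = (W r - P r) * (W r ^ 2 + W r * P r + P r ^ 2) := by ring
  have hp0 : 0 ≤ P r := by linarith
  have hlow : r ^ 2 / 4 ≤ W r ^ 2 + W r * P r + P r ^ 2 := by
    nlinarith [mul_nonneg hw hp0, sq_nonneg (W r)]
  rw [hfac, Real.norm_eq_abs, abs_mul, Real.norm_eq_abs, abs_of_pos (pow_pos hr _),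
    abs_of_nonneg (le_trans (by positivity) hlow)] at hc
  rw [Real.norm_eq_abs, Real.norm_eq_abs, abs_of_pos (pow_pos hr _)]
  have hmul := (mul_le_mul_of_nonneg_left hlow (abs_nonneg (W r - P r))).trans hc
  have hr2 : 0 < r ^ 2 := by positivity
  rw [pow_add] at hmul
  refine le_of_mul_le_mul_right ?_ hr2
  linarith

/-- A continuous multiple of `r ^ n` is `O(r ^ n)` as `r → 0⁺`. -/
theorem isBigO_pow_mul_of_continuous {h : ℝ → ℝ} (hh : Continuous h) (n : ℕ) :
    (fun r => r ^ n * h r) =O[nhdsWithin 0 (Set.Ioi 0)] fun r => r ^ n := by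
  have h1 : h =O[nhdsWithin 0 (Set.Ioi 0)] fun _ => (1 : ℝ) :=
    ((hh.tendsto 0).mono_left nhdsWithin_le_nhds).isBigO_one ℝ
  simpa using (isBigO_refl (fun r : ℝ => r ^ n) _).mul h1

/-- Reparametrization of the Gray–Vanhecke expansion by the volume radius
`W = (3V/4π)^{1/3}`: if `V(r) = (4π/3)r³(1 + c₁r² + c₂r⁴) + O(r⁹)` and
`A(r) = 4πr²(1 + (5/3)c₁r² + (7/3)c₂r⁴) + O(r⁸)` as `r → 0⁺`, then
`A = 4πW²(1 + c₁W² + (−(11/9)c₁² + (5/3)c₂)W⁴) + O(r⁸)`. -/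
theorem area_expansion_in_volume_radius
    (c₁ c₂ : ℝ) (V A : ℝ → ℝ)
    (hV : (fun r => V r - (4 * π / 3) * r ^ 3 * (1 + c₁ * r ^ 2 + c₂ * r ^ 4))
        =O[nhdsWithin 0 (Set.Ioi 0)] fun r => r ^ 9)
    (hA : (fun r => A r - 4 * π * r ^ 2 *
          (1 + (5 / 3) * c₁ * r ^ 2 + (7 / 3) * c₂ * r ^ 4))
        =O[nhdsWithin 0 (Set.Ioi 0)] fun r => r ^ 8)
    (W : ℝ → ℝ) (hW : ∀ r, W r = (3 * V r / (4 * π)) ^ ((1 : ℝ) / 3)) :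
    (fun r => A r - 4 * π * (W r) ^ 2 *
        (1 + c₁ * (W r) ^ 2 + (-(11 / 9) * c₁ ^ 2 + (5 / 3) * c₂) * (W r) ^ 4))
      =O[nhdsWithin 0 (Set.Ioi 0)] fun r => r ^ 8 := by
  set l := nhdsWithin (0 : ℝ) (Set.Ioi 0)
  obtain ⟨a, ha⟩ : ∃ a, a = c₁ / 3 := ⟨_, rfl⟩
  obtain ⟨b, hb⟩ : ∃ b, b = c₂ / 3 - c₁ ^ 2 / 9 := ⟨_, rfl⟩
  obtain ⟨k, hk⟩ : ∃ k, k = -(11 / 9) * c₁ ^ 2 + (5 / 3) * c₂ := ⟨_, rfl⟩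
  obtain ⟨P, hPdef⟩ : ∃ P : ℝ → ℝ, P = fun r => r * (1 + a * r ^ 2 + b * r ^ 4) := ⟨_, rfl⟩
  have hPhalf : ∀ᶠ r in l, r / 2 ≤ P r := by
    have ht : Tendsto (fun r : ℝ => 1 + a * r ^ 2 + b * r ^ 4) l (nhds 1) := by
      have hc : Continuous fun r : ℝ => 1 + a * r ^ 2 + b * r ^ 4 := by fun_prop
      simpa using (hc.tendsto 0).mono_left nhdsWithin_le_nhds
    filter_upwards [ht.eventually (lt_mem_nhds (by norm_num : (1 / 2 : ℝ) < 1)),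
      self_mem_nhdsWithin] with r h hr
    have hr : 0 < r := hr
    rw [hPdef]
    change r / 2 ≤ r * (1 + a * r ^ 2 + b * r ^ 4)
    nlinarith
  have hV3 : (fun r => 3 * V r / (4 * π) - P r ^ 3) =O[l] fun r => r ^ 9 := by
    have hcube := isBigO_pow_mul_of_continuous (h := fun r : ℝ => 6 * a * b + a ^ 3
      + (3 * a ^ 2 * b + 3 * b ^ 2) * r ^ 2 + 3 * a * b ^ 2 * r ^ 4 + b ^ 3 * r ^ 6)
      (by fun_prop) 9
    refine ((hV.const_mul_left (3 / (4 * π))).sub hcube).congr_left fun r => ?_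
    have hpi := Real.pi_ne_zero
    rw [hPdef, ha, hb]
    field_simp
    ring
  have hVnonneg : ∀ᶠ r in l, 0 ≤ 3 * V r / (4 * π) := by
    have ho : (fun r : ℝ => r ^ 9) =o[l] fun r => r ^ 3 :=
      (isLittleO_pow_pow (by norm_num)).mono nhdsWithin_le_nhds
    filter_upwards [(hV3.trans_isLittleO ho).bound (by norm_num : (0 : ℝ) < 1 / 8), hPhalf,
      self_mem_nhdsWithin] with r h hp hr
    have hr : 0 < r := hr
    rw [Real.norm_eq_abs, Real.norm_eq_abs, abs_of_pos (pow_pos hr 3)] at h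
    have h3 : (r / 2) ^ 3 ≤ P r ^ 3 := by gcongr
    have := (abs_le.mp h).1
    nlinarith
  have hWnonneg : ∀ᶠ r in l, 0 ≤ W r := by
    filter_upwards [hVnonneg] with r h
    rw [hW]
    positivity
  have hWP : (fun r => W r - P r) =O[l] fun r => r ^ 7 := by
    refine isBigO_sub_of_isBigO_cube_sub hWnonneg hPhalf (hV3.congr' ?_ EventuallyEq.rfl)
    filter_upwards [hVnonneg] with r h
    have hroot : W r ^ 3 = 3 * V r / (4 * π) := by
      rw [hW, ← Real.rpow_natCast, ← Real.rpow_mul h]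
      norm_num
    rw [hroot]
  have hPO : P =O[l] fun r => r := by
    have := isBigO_pow_mul_of_continuous (h := fun r : ℝ => 1 + a * r ^ 2 + b * r ^ 4)
      (by fun_prop) 1
    simpa [hPdef] using this
  have h71 : (fun r : ℝ => r ^ 7) =O[l] fun r => r := by
    simpa using ((isLittleO_pow_pow (𝕜 := ℝ) (by norm_num : 1 < 7)).isBigO.mono
      (nhdsWithin_le_nhds (s := Set.Ioi 0)))
  have hWO : W =O[l] fun r => r :=
    ((hWP.trans h71).add hPO).congr_left fun r => by ring
  have hid : Tendsto (fun r : ℝ => r) l (nhds 0) := tendsto_id.mono_left nhdsWithin_le_nhds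
  have hP0 : Tendsto P l (nhds 0) := hPO.trans_tendsto hid
  have hW0 : Tendsto W l (nhds 0) := hWO.trans_tendsto hid
  have hquot : (fun r => 4 * π * (1 + c₁ * (W r ^ 2 + P r ^ 2)
      + k * (W r ^ 4 + W r ^ 2 * P r ^ 2 + P r ^ 4))) =O[l] fun _ => (1 : ℝ) := by
    have hc : Continuous fun p : ℝ × ℝ => 4 * π * (1 + c₁ * (p.1 ^ 2 + p.2 ^ 2)
      + k * (p.1 ^ 4 + p.1 ^ 2 * p.2 ^ 2 + p.2 ^ 4)) := by fun_prop
    exact ((hc.tendsto (0, 0)).comp (hW0.prodMk_nhds hP0)).isBigO_one ℝ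
  have hsubst : (fun r => (W r - P r) * (W r + P r) * (4 * π * (1 + c₁ * (W r ^ 2 + P r ^ 2)
      + k * (W r ^ 4 + W r ^ 2 * P r ^ 2 + P r ^ 4)))) =O[l] fun r => r ^ 8 :=
    ((hWP.mul (hWO.add hPO)).mul hquot).congr_right fun r => by ring
  have hpoly := isBigO_pow_mul_of_continuous (h := fun r : ℝ =>
    -(4 * π) * ((2 * a * b + b ^ 2 * r ^ 2)
      + c₁ * (2 * (2 * b + (a + b * r ^ 2) ^ 2)
        + (2 * (a + b * r ^ 2) + r ^ 2 * (a + b * r ^ 2) ^ 2) ^ 2)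
      + k * (3 * (2 * (a + b * r ^ 2) + r ^ 2 * (a + b * r ^ 2) ^ 2)
        + 3 * r ^ 2 * (2 * (a + b * r ^ 2) + r ^ 2 * (a + b * r ^ 2) ^ 2) ^ 2
        + r ^ 4 * (2 * (a + b * r ^ 2) + r ^ 2 * (a + b * r ^ 2) ^ 2) ^ 3)))
    (by fun_prop) 8
  rw [← hk]
  refine ((hA.sub hsubst).add hpoly).congr_left fun r => ?_
  have hc₁ : c₁ = 3 * a := by rw [ha]; ring
  have hc₂ : c₂ = 3 * b + 3 * a ^ 2 := by rw [hb, ha]; ring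
  have hk' : k = 5 * b - 6 * a ^ 2 := by rw [hk, hc₁, hc₂]; ring
  rw [hPdef, hk', hc₁, hc₂]
  ring
end
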